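/- arXiv:2310.03419 — 2 statements merged into one kernel-verified Lean document; each statement's English description precedes it below -/
import Mathlib

section
/- Let G be a finite directed acyclic graph with initial state s₀ and terminal states X (the childless states). Fix an outcome y ∈ X, let R(x|y) = 1 if x = y and 0 otherwise, and assume the constraint F(s|y)·P_F(s'|s, y) = F(s'|y)·P_B(s|s', y)·R(sₙ|y) holds along every edge of every trajectory τ = (s₀, …, sₙ). Then for every terminal state x ≠ y, F(s₀|y) · P(x|y) = 0, where P(x|y) is the total forward probability, conditioned on y, of trajectories terminating at x. -/
/-- Product of an edge-indexed quantity `P` over consecutive pairs of a list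
(the edges of a trajectory). -/
def stepProd {S : Type*} (P : S → S → ℝ) : List S → ℝ
  | a :: b :: l => P a b * stepProd P (b :: l)
  | _ => 1

/-- Conditional reward: `R(x|y) = 1` if `x = y` and `0` otherwise. -/
def Rw {S : Type*} [DecidableEq S] (x y : S) : ℝ := if x = y then 1 else 0

/-- `l` is a trajectory: a sequence `(s₀, s₁, …, sₙ)` with `n ≥ 1`, following edges of the
graph, starting at the initial state `s₀` and ending at a terminal (childless) state. -/
def IsTraj {S : Type*} (E : S → S → Prop) (s0 : S) (l : List S) : Prop :=
  2 ≤ l.length ∧ l.head? = some s0 ∧ l.Chain' E ∧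
    ∀ x, l.getLast? = some x → ∀ s', ¬ E x s'

/-- in a finite DAG, fix a terminal outcome `y` and assume the
detailed-balance-with-reward constraint `F(s|y)·P_F(s'|s,y) = F(s'|y)·P_B(s|s',y)·R(sₙ|y)`
holds along every edge of every trajectory `τ = (s₀,…,sₙ)`.  Then for every terminal
state `x ≠ y`, `F(s₀|y) · P(x|y) = 0`, where `P(x|y)` is the total forward probability of
trajectories terminating at `x`.
Here `PF a b = P_F(b|a,y)`, `PB a b = P_B(a|b,y)` and `F s = F(s|y)`. -/
theorem stmt_4 {S : Type*} [Fintype S] [DecidableEq S]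
    (E : S → S → Prop) (s0 y x : S)
    -- the graph is acyclic
    (hacyc : ∀ s, ¬ Relation.TransGen E s s)
    -- the outcome y is a terminal (childless) state
    (hyterm : ∀ s', ¬ E y s')
    -- x is a terminal (childless) state different from y
    (hxterm : ∀ s', ¬ E x s')
    (hxy : x ≠ y)
    (F : S → ℝ) (PF PB : S → S → ℝ)
    (hFnn : ∀ s, 0 ≤ F s) (hPFnn : ∀ a b, 0 ≤ PF a b) (hPBnn : ∀ a b, 0 ≤ PB a b)
    -- the constraint holds along every edge of every trajectory
    (hDB : ∀ l : List S, IsTraj E s0 l → ∀ x', l.getLast? = some x' →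
      ∀ a b, (a, b) ∈ l.zip l.tail → F a * PF a b = F b * PB a b * Rw x' y)
    -- there are finitely many trajectories (G is finite and acyclic)
    [Fintype {l : List S // IsTraj E s0 l ∧ l.getLast? = some x}] :
    F s0 *
      ∑ τ : {l : List S // IsTraj E s0 l ∧ l.getLast? = some x}, stepProd PF τ.1 = 0 := by
  rw [Finset.mul_sum]
  refine Finset.sum_eq_zero ?_
  rintro ⟨l, hl, hlast⟩ -
  match l, hl, hlast with
  | [], hl, _ => simp [IsTraj] at hl
  | [_], hl, _ => simp [IsTraj] at hl
  | a :: b :: l, hl, hlast =>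
    have ha : a = s0 := by simpa using hl.2.1
    have hab : F a * PF a b = 0 := by
      simpa [Rw, hxy] using hDB _ hl x hlast a b (by simp)
    subst ha
    rw [stepProd, ← mul_assoc, hab, zero_mul]
end

section
/- Let Y be a finite set of outcomes, r : Y → ℝ, and for each outcome y let F(·|y) be an outcome-conditioned state flow with forward policy P_F(s'|s, y) and backward policy P_B(s|s', y). Fix an edge s → s' and suppose the outcome-conditioned detailed balance constraint F(s|y)·P_F(s'|s, y) = F(s'|y)·P_B(s|s', y) holds for every outcome y ∈ Y. Define F^r(u) = Σ_{y ∈ Y} r(y)·F(u|y), and assume F^r(s) ≠ 0 and F^r(s') ≠ 0, and define P_F^r(s'|s) = (Σ_y r(y)·F(s|y)·P_F(s'|s, y)) / F^r(s) and P_B^r(s|s') = (Σ_y r(y)·F(s'|y)·P_B(s|s', y)) / F^r(s'). Then the detailed balance constraint holds for the converted quantities: F^r(s)·P_F^r(s'|s) = F^r(s')·P_B^r(s|s'). -/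
/-- let `Y` be a finite set of outcomes with reward `r : Y → ℝ`; for a fixed
edge `s → s'`, write `Fs y = F(s|y)`, `Fs' y = F(s'|y)`, `PF y = P_F(s'|s,y)` and
`PB y = P_B(s|s',y)`.  If the outcome-conditioned detailed balance constraint
`F(s|y)·P_F(s'|s,y) = F(s'|y)·P_B(s|s',y)` holds for every outcome `y`, and the converted
flows `F^r(s) = Σ_y r(y)·F(s|y)` and `F^r(s') = Σ_y r(y)·F(s'|y)` are nonzero, then
detailed balance holds for the converted quantities:
`F^r(s)·P_F^r(s'|s) = F^r(s')·P_B^r(s|s')`, where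
`P_F^r(s'|s) = (Σ_y r(y)·F(s|y)·P_F(s'|s,y)) / F^r(s)` and
`P_B^r(s|s') = (Σ_y r(y)·F(s'|y)·P_B(s|s',y)) / F^r(s')`. -/
theorem stmt_7 {Y : Type*} [Fintype Y]
    (r Fs Fs' PF PB : Y → ℝ)
    (hDB : ∀ y, Fs y * PF y = Fs' y * PB y)
    (hFr : (∑ y, r y * Fs y) ≠ 0)
    (hFr' : (∑ y, r y * Fs' y) ≠ 0) :
    (∑ y, r y * Fs y) * ((∑ y, r y * Fs y * PF y) / (∑ y, r y * Fs y)) =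
      (∑ y, r y * Fs' y) * ((∑ y, r y * Fs' y * PB y) / (∑ y, r y * Fs' y)) := by
  rw [mul_div_cancel₀ _ hFr, mul_div_cancel₀ _ hFr']
  exact Finset.sum_congr rfl fun y _ => by rw [mul_assoc, hDB, ← mul_assoc]
end
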